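/- Let b_n denote the number of integer solutions of the system B_n (for n ≥ 13) and let t_n denote the number of integer solutions of the system T_n (for n ≥ 12). Then the quotient t_n / b_n tends to infinity as n tends to infinity; equivalently, for every real M there exists an integer n_0 ≥ 13 such that t_n > M · b_n for all integers n ≥ n_0. -/

import Mathlib

/-- The system `B_n` of Browkin, in the unknowns `x 1, …, x n`. -/
def BSys (n : ℕ) (x : ℕ → ℤ) : Prop :=
  (∀ i, 1 ≤ i → i ≤ n - 13 → x i * x i = x (i + 1)) ∧
  x (n - 11) + x (n - 11) = x 1 ∧
  x (n - 11) * x (n - 11) = x 1 ∧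
  x (n - 10) * x (n - 10) = x (n - 9) ∧
  x (n - 8) * x (n - 8) = x (n - 7) ∧
  x (n - 6) * x (n - 6) = x (n - 5) ∧
  x (n - 4) * x (n - 4) = x (n - 3) ∧
  x (n - 9) + x (n - 7) = x (n - 2) ∧
  x (n - 5) + x (n - 3) = x (n - 1) ∧
  x (n - 2) + x (n - 1) = x n ∧
  x (n - 11) + x (n - 12) = x n

/-- The system `T_n`, in the unknowns `x 1, …, x n`. -/
def TSys (n : ℕ) (x : ℕ → ℤ) : Prop :=
  (∀ i, 1 ≤ i → i ≤ n - 12 → x i * x i = x (i + 1)) ∧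
  x (n - 10) * x (n - 10) = x (n - 10) ∧
  x (n - 10) + x (n - 10) = x (n - 9) ∧
  x (n - 8) + x (n - 9) = x 1 ∧
  x (n - 8) * x (n - 7) = x (n - 11) ∧
  x (n - 10) * x (n - 7) = x (n - 7) ∧
  x (n - 6) * x (n - 6) = x (n - 5) ∧
  x (n - 4) * x (n - 4) = x (n - 3) ∧
  x (n - 2) * x (n - 2) = x (n - 1) ∧
  x (n - 5) + x (n - 3) = x n ∧
  x (n - 1) + x n = x (n - 11)

/-- `b n` is the number of integer solutions of `B_n`, the solutions being encoded as
functions `ℕ → ℤ` vanishing outside `{1, …, n}`. -/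
noncomputable def b (n : ℕ) : ℕ :=
  {x : ℕ → ℤ | (∀ i, i = 0 ∨ n < i → x i = 0) ∧ BSys n x}.ncard

/-- `t n` is the number of integer solutions of `T_n`, the solutions being encoded as
functions `ℕ → ℤ` vanishing outside `{1, …, n}`. -/
noncomputable def t (n : ℕ) : ℕ :=
  {x : ℕ → ℤ | (∀ i, i = 0 ∨ n < i → x i = 0) ∧ TSys n x}.ncard

/-- Iterated squaring along indices `1, …, N + 1`. -/
lemma sq_chain {x : ℕ → ℤ} {N : ℕ} (h : ∀ i, 1 ≤ i → i ≤ N → x i * x i = x (i + 1)) :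
    ∀ i, i ≤ N → x (i + 1) = x 1 ^ 2 ^ i := by
  intro i
  induction i with
  | zero => simp
  | succ k ih =>
    intro hk
    rw [← h (k + 1) (by omega) hk, ih (by omega), ← pow_two, ← pow_mul, pow_succ]

lemma BSys_ext {m : ℕ} {x y : ℕ → ℤ}
    (hx0 : ∀ i, i = 0 ∨ m + 13 < i → x i = 0) (hx : BSys (m + 13) x)
    (hy0 : ∀ i, i = 0 ∨ m + 13 < i → y i = 0) (hy : BSys (m + 13) y)
    (h₂ : x (m + 2) = y (m + 2)) (h₃ : x (m + 3) = y (m + 3)) (h₅ : x (m + 5) = y (m + 5))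
    (h₇ : x (m + 7) = y (m + 7)) (h₉ : x (m + 9) = y (m + 9)) : x = y := by
  obtain ⟨hx, x1, -, x4, x6, x8, x10, x11, x12, x13, -⟩ := hx
  obtain ⟨hy, y1, -, y4, y6, y8, y10, y11, y12, y13, -⟩ := hy
  simp only [Nat.reduceSubDiff, Nat.add_sub_cancel] at *
  have e1 : x 1 = y 1 := by rw [← x1, ← y1, h₂]
  have e4 : x (m + 4) = y (m + 4) := by rw [← x4, ← y4, h₃]
  have e6 : x (m + 6) = y (m + 6) := by rw [← x6, ← y6, h₅]
  have e8 : x (m + 8) = y (m + 8) := by rw [← x8, ← y8, h₇]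
  have e10 : x (m + 10) = y (m + 10) := by rw [← x10, ← y10, h₉]
  have e11 : x (m + 11) = y (m + 11) := by rw [← x11, ← y11, e4, e6]
  have e12 : x (m + 12) = y (m + 12) := by rw [← x12, ← y12, e8, e10]
  have e13 : x (m + 13) = y (m + 13) := by rw [← x13, ← y13, e11, e12]
  funext i
  by_cases hi : i = 0 ∨ m + 13 < i
  · rw [hx0 i hi, hy0 i hi]
  by_cases hi' : i ≤ m + 1
  · obtain ⟨j, rfl⟩ : ∃ j, i = j + 1 := ⟨i - 1, by omega⟩
    rw [sq_chain hx j (by omega), sq_chain hy j (by omega), e1]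
  · obtain ⟨j, rfl⟩ : ∃ j, i = m + 2 + j := ⟨i - (m + 2), by omega⟩
    have hj : j ≤ 11 := by omega
    interval_cases j <;> assumption

lemma TSys_ext {m : ℕ} {x y : ℕ → ℤ}
    (hx0 : ∀ i, i = 0 ∨ m + 13 < i → x i = 0) (hx : TSys (m + 13) x)
    (hy0 : ∀ i, i = 0 ∨ m + 13 < i → y i = 0) (hy : TSys (m + 13) y)
    (h₃ : x (m + 3) = y (m + 3)) (h₅ : x (m + 5) = y (m + 5)) (h₆ : x (m + 6) = y (m + 6))
    (h₇ : x (m + 7) = y (m + 7)) (h₉ : x (m + 9) = y (m + 9))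
    (h₁₁ : x (m + 11) = y (m + 11)) : x = y := by
  obtain ⟨hx, -, x4, x1, -, -, x8, x10, x12, x13, -⟩ := hx
  obtain ⟨hy, -, y4, y1, -, -, y8, y10, y12, y13, -⟩ := hy
  simp only [Nat.reduceSubDiff] at *
  have e4 : x (m + 4) = y (m + 4) := by rw [← x4, ← y4, h₃]
  have e1 : x 1 = y 1 := by rw [← x1, ← y1, h₅, e4]
  have e8 : x (m + 8) = y (m + 8) := by rw [← x8, ← y8, h₇]
  have e10 : x (m + 10) = y (m + 10) := by rw [← x10, ← y10, h₉]
  have e12 : x (m + 12) = y (m + 12) := by rw [← x12, ← y12, h₁₁]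
  have e13 : x (m + 13) = y (m + 13) := by rw [← x13, ← y13, e8, e10]
  funext i
  by_cases hi : i = 0 ∨ m + 13 < i
  · rw [hx0 i hi, hy0 i hi]
  by_cases hi' : i ≤ m + 2
  · obtain ⟨j, rfl⟩ : ∃ j, i = j + 1 := ⟨i - 1, by omega⟩
    rw [sq_chain hx j (by omega), sq_chain hy j (by omega), e1]
  · obtain ⟨j, rfl⟩ : ∃ j, i = m + 3 + j := ⟨i - (m + 3), by omega⟩
    have hj : j ≤ 10 := by omega
    interval_cases j <;> assumption

lemma b_le (m : ℕ) : b (m + 13) ≤ 1250 * 16 ^ 2 ^ m := by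
  set H : ℕ := 2 ^ 2 ^ m with hH
  have hH1 : 1 ≤ H := Nat.one_le_two_pow
  set I : Finset ℤ := Finset.Icc (-(H + 1 : ℤ)) (H + 1) with hI
  have hIc : I.card ≤ 5 * H := by
    rw [hI, Int.card_Icc]
    omega
  set S : Finset (ℤ × ℤ × ℤ × ℤ × ℤ) := ({0, 2} : Finset ℤ) ×ˢ I ×ˢ I ×ˢ I ×ˢ I with hS
  have hSc : S.card ≤ 1250 * 16 ^ 2 ^ m := by
    have h2 : ({0, 2} : Finset ℤ).card = 2 := rfl
    calc S.card = 2 * (I.card * (I.card * (I.card * I.card))) := by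
          simp only [hS, Finset.card_product, h2]
      _ ≤ 2 * ((5 * H) * ((5 * H) * ((5 * H) * (5 * H)))) := by gcongr
      _ = 1250 * H ^ 4 := by ring
      _ = 1250 * 16 ^ 2 ^ m := by rw [hH, ← pow_mul, mul_comm (2 ^ m), pow_mul]; norm_num
  refine le_trans ?_ hSc
  rw [← Set.ncard_coe_finset S]
  refine Set.ncard_le_ncard_of_injOn
    (fun x => (x (m + 2), x (m + 3), x (m + 5), x (m + 7), x (m + 9))) ?_ ?_ S.finite_toSet
  · rintro x ⟨-, hc, x1, x1', x4, x6, x8, x10, x11, x12, x13, xn⟩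
    simp only [Nat.reduceSubDiff, Nat.add_sub_cancel] at *
    have hm := sq_chain hc m le_rfl
    have h02 : x (m + 2) = 0 ∨ x (m + 2) = 2 := by
      have : x (m + 2) * (x (m + 2) - 2) = 0 := by linarith
      rcases mul_eq_zero.1 this with h | h
      · exact Or.inl h
      · exact Or.inr (by linarith)
    have hle : x (m + 13) ≤ (H + 1 : ℤ) ^ 2 := by
      have hHz : (1 : ℤ) ≤ H := by exact_mod_cast hH1
      rcases h02 with h | h
      · rw [← xn, hm, ← x1, h]
        simp only [add_zero, zero_add]
        rw [zero_pow (by positivity)]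
        positivity
      · rw [← xn, hm, ← x1, h]
        have : ((2 : ℤ) + 2) ^ 2 ^ m = (H : ℤ) ^ 2 := by
          rw [hH]
          push_cast
          rw [← pow_mul, mul_comm, pow_mul]
          norm_num
        rw [this]
        nlinarith
    have mem : ∀ z : ℤ, z * z ≤ (H + 1 : ℤ) ^ 2 → z ∈ I := fun z hz => by
      have := abs_le_of_sq_le_sq' (by linarith [pow_two z] : z ^ 2 ≤ (H + 1 : ℤ) ^ 2) (by positivity)
      exact Finset.mem_Icc.2 this
    have q3 := mul_self_nonneg (x (m + 3))
    have q5 := mul_self_nonneg (x (m + 5))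
    have q7 := mul_self_nonneg (x (m + 7))
    have q9 := mul_self_nonneg (x (m + 9))
    simp only [hS, Finset.coe_product, Set.mem_prod, Finset.mem_coe]
    refine ⟨by simpa using h02, mem _ ?_, mem _ ?_, mem _ ?_, mem _ ?_⟩ <;> linarith
  · rintro x ⟨hx0, hx⟩ y ⟨hy0, hy⟩ h
    simp only [Prod.mk.injEq] at h
    exact BSys_ext hx0 hx hy0 hy h.1 h.2.1 h.2.2.1 h.2.2.2.1 h.2.2.2.2

lemma TSys_finite (m : ℕ) :
    {x : ℕ → ℤ | (∀ i, i = 0 ∨ m + 13 < i → x i = 0) ∧ TSys (m + 13) x}.Finite := by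
  set K : ℕ := 2 ^ (m + 1) with hK
  have hK0 : K ≠ 0 := by positivity
  set C : ℤ := (2 ^ K + 2) ^ K with hC
  have h2K : (1 : ℤ) ≤ 2 ^ K := one_le_pow₀ (by norm_num)
  have hCK : (2 : ℤ) ^ K + 2 ≤ C := le_self_pow₀ (by linarith) hK0
  set I : Finset ℤ := Finset.Icc (-C) C with hI
  set S : Finset (ℤ × ℤ × ℤ × ℤ × ℤ × ℤ) := I ×ˢ I ×ˢ I ×ˢ I ×ˢ I ×ˢ I with hS
  refine Set.Finite.of_finite_image (f := fun x : ℕ → ℤ =>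
    (x (m + 3), x (m + 5), x (m + 6), x (m + 7), x (m + 9), x (m + 11)))
    (S.finite_toSet.subset ?_) ?_
  · rintro _ ⟨x, ⟨-, hc, x3, x4, x1, x5, x6, x8, x10, x12, x13, xn⟩, rfl⟩
    simp only [Nat.reduceSubDiff] at *
    have hm : x (m + 2) = x 1 ^ K := sq_chain hc (m + 1) le_rfl
    have mem : ∀ z : ℤ, |z| ≤ C → z ∈ I := fun z hz => Finset.mem_Icc.2 (abs_le.1 hz)
    have h01 : x (m + 3) = 0 ∨ x (m + 3) = 1 := by
      have : x (m + 3) * (x (m + 3) - 1) = 0 := by linarith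
      rcases mul_eq_zero.1 this with h | h
      · exact Or.inl h
      · exact Or.inr (by linarith)
    have key : |x (m + 3)| ≤ C ∧ |x (m + 5)| ≤ C ∧ |x (m + 6)| ≤ C ∧ x (m + 2) ≤ C := by
      rcases h01 with h | h
      · have h6 : x (m + 6) = 0 := by rw [← x6, h, zero_mul]
        have h2 : x (m + 2) = 0 := by rw [← x5, h6, mul_zero]
        have h1 : x 1 = 0 := by
          rw [hm] at h2
          exact pow_eq_zero_iff hK0 |>.1 h2
        have h5 : x (m + 5) = 0 := by linarith
        rw [h, h5, h6, h2, abs_zero]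
        refine ⟨?_, ?_, ?_, ?_⟩ <;> linarith
      · have h1 : x 1 - 2 = x (m + 5) := by linarith
        have hd : x (m + 5) ∣ 2 ^ K := by
          have hd1 : x (m + 5) ∣ x 1 ^ K - 2 ^ K := h1 ▸ sub_dvd_pow_sub_pow (x 1) 2 K
          have hd2 : x (m + 5) ∣ x 1 ^ K := ⟨x (m + 6), by rw [← hm, x5]⟩
          exact (dvd_sub_right hd2).1 hd1
        have h0 : x (m + 5) ≠ 0 := fun h0 => by
          rw [h0, zero_dvd_iff] at hd
          linarith
        have h5 : |x (m + 5)| ≤ 2 ^ K :=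
          Int.le_of_dvd (by linarith) ((abs_dvd _ _).2 hd)
        have ha1 : |x 1| ≤ 2 ^ K + 2 := by
          rw [abs_le] at *
          constructor <;> linarith
        have h2 : |x (m + 2)| ≤ C := by
          rw [hm, abs_pow]
          exact pow_le_pow_left₀ (abs_nonneg _) ha1 K
        have h6 : |x (m + 6)| ≤ |x (m + 2)| := by
          rw [← x5, abs_mul]
          exact le_mul_of_one_le_left (abs_nonneg _) (Int.one_le_abs h0)
        refine ⟨?_, by linarith, by linarith, (le_abs_self _).trans h2⟩
        rw [h, abs_one]
        linarith
    have hsq : ∀ z : ℤ, z * z ≤ C → |z| ≤ C := fun z hz => by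
      have h1 : |z| * |z| = z * z := abs_mul_abs_self z
      by_contra! h
      nlinarith
    have q7 := mul_self_nonneg (x (m + 7))
    have q9 := mul_self_nonneg (x (m + 9))
    have q11 := mul_self_nonneg (x (m + 11))
    obtain ⟨k3, k5, k6, k2⟩ := key
    simp only [hS, Finset.coe_product, Set.mem_prod, Finset.mem_coe]
    refine ⟨mem _ k3, mem _ k5, mem _ k6, mem _ (hsq _ ?_), mem _ (hsq _ ?_), mem _ (hsq _ ?_)⟩ <;>
      linarith
  · rintro x ⟨hx0, hx⟩ y ⟨hy0, hy⟩ h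
    simp only [Prod.mk.injEq] at h
    exact TSys_ext hx0 hx hy0 hy h.1 h.2.1 h.2.2.1 h.2.2.2.1 h.2.2.2.2.1 h.2.2.2.2.2

/-- Three similarities of `ℤ³` of ratio `3`; they generate a free monoid. -/
def tripleStep : Fin 3 → ℤ × ℤ × ℤ → ℤ × ℤ × ℤ
  | 0, (x, y, z) => (2 * (x + y + z) - 3 * x, 3 * y - 2 * (x + y + z), 3 * z - 2 * (x + y + z))
  | 1, (x, y, z) => (3 * x - 2 * (x + y + z), 2 * (x + y + z) - 3 * y, 3 * z - 2 * (x + y + z))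
  | 2, (x, y, z) => (3 * x - 2 * (x + y + z), 3 * y - 2 * (x + y + z), 2 * (x + y + z) - 3 * z)

lemma exists_triples (a : ℕ) : ∃ F : Finset (ℤ × ℤ × ℤ), F.card = 3 ^ a ∧
    ∀ v ∈ F, v.1 ^ 2 + v.2.1 ^ 2 + v.2.2 ^ 2 = 9 ^ a ∧ (v.1 + v.2.1 + v.2.2) % 3 = 1 := by
  induction a with
  | zero => exact ⟨{(1, 0, 0)}, by simp, by simp⟩
  | succ a ih =>
    obtain ⟨F, hF, h⟩ := ih
    refine ⟨((Finset.univ : Finset (Fin 3)) ×ˢ F).image (fun p => tripleStep p.1 p.2), ?_, ?_⟩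
    · rw [Finset.card_image_of_injOn, Finset.card_product, hF, Finset.card_univ, Fintype.card_fin,
        pow_succ, mul_comm]
      rintro ⟨i, x, y, z⟩ hv ⟨j, x', y', z'⟩ hw heq
      have hv := (h _ (Finset.mem_product.1 hv).2).2
      have hw := (h _ (Finset.mem_product.1 hw).2).2
      fin_cases i <;> fin_cases j <;>
        simp [tripleStep] at hv hw heq ⊢ <;> omega
    · simp only [Finset.mem_image, Finset.mem_product, Finset.mem_univ, true_and]
      rintro _ ⟨⟨i, x, y, z⟩, hv, rfl⟩
      obtain ⟨hn, hs⟩ := h _ hv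
      simp only at hn hs
      rw [pow_succ 9, ← hn]
      fin_cases i <;> simp only [tripleStep] <;> refine ⟨by ring, by omega⟩

/-- The solution of `T_{m+13}` with `x 1 = 1026` attached to a sum of three squares. -/
def tSol (m : ℕ) (w : ℤ) (u v s : ℤ) (i : ℕ) : ℤ :=
  if i = 0 then 0 else
  if i ≤ m + 2 then 1026 ^ 2 ^ (i - 1) else
  if i = m + 3 then 1 else
  if i = m + 4 then 2 else
  if i = m + 5 then 1024 else
  if i = m + 6 then w else
  if i = m + 7 then u else
  if i = m + 8 then u * u else
  if i = m + 9 then v else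
  if i = m + 10 then v * v else
  if i = m + 11 then s else
  if i = m + 12 then s * s else
  if i = m + 13 then u * u + v * v else 0

lemma tSol_TSys {m : ℕ} {w u v s : ℤ} (hw : 1024 * w = 1026 ^ 2 ^ (m + 1))
    (h : s * s + (u * u + v * v) = 1026 ^ 2 ^ (m + 1)) : TSys (m + 13) (tSol m w u v s) := by
  refine ⟨?_, ?_⟩
  · intro i h1 h2
    obtain ⟨j, rfl⟩ : ∃ j, i = j + 1 := ⟨i - 1, by omega⟩
    have h3 : j + 1 ≤ m + 2 := by omega
    have h4 : j + 1 + 1 ≤ m + 2 := by omega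
    simp only [tSol, Nat.add_eq_zero_iff, one_ne_zero, and_false, if_false, h3, h4, if_true,
      Nat.add_sub_cancel]
    rw [← pow_two, ← pow_mul, ← pow_succ]
  · simp [tSol, hw, h]

lemma le_t {m : ℕ} (hm : 3 ≤ m) : 27 ^ 2 ^ m ≤ t (m + 13) := by
  obtain ⟨F, hF, hF'⟩ := exists_triples (3 * 2 ^ m)
  have hP : 8 ≤ 2 ^ m := by
    calc 8 = 2 ^ 3 := rfl
      _ ≤ 2 ^ m := Nat.pow_le_pow_right (by norm_num) hm
  obtain ⟨w, hw⟩ : (1024 : ℤ) ∣ 1026 ^ 2 ^ (m + 1) := by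
    have h1 : (1024 : ℤ) ∣ 1026 ^ 10 := by norm_num
    exact h1.trans (pow_dvd_pow _ (by rw [pow_succ]; omega))
  set c : ℤ := 38 ^ 2 ^ m with hc
  have hc0 : c ≠ 0 := by positivity
  have hcard : 27 ^ 2 ^ m = F.card := by
    rw [hF, pow_mul]
    norm_num
  rw [hcard, ← Set.ncard_coe_finset F]
  refine Set.ncard_le_ncard_of_injOn
    (fun p => tSol m w (c * p.1) (c * p.2.1) (c * p.2.2)) ?_ ?_ (TSys_finite m)
  · rintro ⟨x, y, z⟩ hp
    obtain ⟨hn, -⟩ := hF' _ hp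
    refine ⟨?_, tSol_TSys hw.symm ?_⟩
    · rintro i (rfl | hi)
      · simp [tSol]
      · simp only [tSol]
        repeat rw [if_neg (by omega)]
    · simp only at hn ⊢
      calc _ = c ^ 2 * (x ^ 2 + y ^ 2 + z ^ 2) := by ring
        _ = 1026 ^ 2 ^ (m + 1) := by
          rw [hn, hc, pow_succ 2 m, pow_mul 9, ← pow_mul, mul_comm (2 ^ m) 2, pow_mul 38,
            pow_mul 1026, ← mul_pow]
          norm_num
  · rintro ⟨x, y, z⟩ - ⟨x', y', z'⟩ - h
    have h7 := congrFun h (m + 7)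
    have h9 := congrFun h (m + 9)
    have h11 := congrFun h (m + 11)
    simp [tSol, hc0] at h7 h9 h11
    simp [h7, h9, h11]

theorem stmt8 :
    ∀ M : ℝ, ∃ n₀ : ℕ, 13 ≤ n₀ ∧ ∀ n : ℕ, n₀ ≤ n → M * (b n : ℝ) < (t n : ℝ) := by
  intro M
  have hlim : Filter.Tendsto (fun m : ℕ => (27 / 16 : ℝ) ^ 2 ^ m) Filter.atTop Filter.atTop :=
    (tendsto_pow_atTop_atTop_of_one_lt (by norm_num)).comp
      (tendsto_pow_atTop_atTop_of_one_lt one_lt_two)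
  obtain ⟨N, hN⟩ := Filter.eventually_atTop.1 (hlim.eventually_gt_atTop (|M| * 1250))
  refine ⟨max N 3 + 13, by omega, fun n hn => ?_⟩
  obtain ⟨m, rfl⟩ : ∃ m, n = m + 13 := ⟨n - 13, by omega⟩
  have hb : (b (m + 13) : ℝ) ≤ 1250 * 16 ^ 2 ^ m := by exact_mod_cast b_le m
  have ht : (27 : ℝ) ^ 2 ^ m ≤ t (m + 13) := by exact_mod_cast le_t (m := m) (by omega)
  have hlt := hN m (by omega)
  rw [div_pow, lt_div_iff₀ (by positivity)] at hlt
  calc M * (b (m + 13) : ℝ) ≤ |M| * b (m + 13) := by gcongr; exact le_abs_self M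
    _ ≤ |M| * (1250 * 16 ^ 2 ^ m) := by gcongr
    _ = |M| * 1250 * 16 ^ 2 ^ m := by ring
    _ < 27 ^ 2 ^ m := hlt
    _ ≤ t (m + 13) := ht
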